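/- Let n ≥ 1, let B be a positive definite n×n complex matrix, let Δ be a Hermitian n×n complex matrix such that B + Δ is positive definite, let θ be a real number with 0 ≤ θ ≤ 1, and let m ≥ 1 be a natural number. Then Re(trace(Δ * ((B + Δ)^{1+θ} − B^{1+θ}) * B^m)) ≥ Re(trace(Δ * Δ * B^{m+θ})). -/

import Mathlib

open ComplexOrder

namespace Matrix.IsHermitian

variable {n : Type*} [Fintype n] [DecidableEq n] {A B : Matrix n n ℂ}

theorem cfc_mul_eigenvectorUnitary (hA : A.IsHermitian) (f : ℝ → ℝ) :
    cfc f A * (hA.eigenvectorUnitary : Matrix n n ℂ) =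
      hA.eigenvectorUnitary * diagonal fun i => (f (hA.eigenvalues i) : ℂ) := by
  rw [hA.cfc_eq, IsHermitian.cfc, Unitary.conjStarAlgAut_apply, mul_assoc,
    Unitary.coe_star_mul_self, mul_one]
  rfl

theorem star_eigenvectorUnitary_mul_cfc (hA : A.IsHermitian) (f : ℝ → ℝ) :
    star (hA.eigenvectorUnitary : Matrix n n ℂ) * cfc f A =
      (diagonal fun i => (f (hA.eigenvalues i) : ℂ)) *
        star (hA.eigenvectorUnitary : Matrix n n ℂ) := by
  rw [hA.cfc_eq, IsHermitian.cfc, Unitary.conjStarAlgAut_apply, ← mul_assoc, ← mul_assoc,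
    Unitary.coe_star_mul_self, one_mul]
  rfl

/-- The matrix of overlaps between the eigenvectors of `A` and those of `B`. -/
noncomputable def overlap (hA : A.IsHermitian) (hB : B.IsHermitian) : Matrix n n ℂ :=
  star (hA.eigenvectorUnitary : Matrix n n ℂ) * (hB.eigenvectorUnitary : Matrix n n ℂ)

theorem star_mul_cfc_sub_cfc_mul_apply (hA : A.IsHermitian) (hB : B.IsHermitian) (f : ℝ → ℝ)
    (i j : n) :
    (star (hA.eigenvectorUnitary : Matrix n n ℂ) * (cfc f A - cfc f B) *
        (hB.eigenvectorUnitary : Matrix n n ℂ)) i j =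
      (f (hA.eigenvalues i) - f (hB.eigenvalues j)) * hA.overlap hB i j := by
  rw [mul_sub, sub_mul, star_eigenvectorUnitary_mul_cfc, mul_assoc, mul_assoc (star _) (cfc f B),
    cfc_mul_eigenvectorUnitary, ← mul_assoc (star _), sub_apply, diagonal_mul, mul_diagonal,
    ← overlap]
  ring

theorem trace_cfc_sub_mul_cfc_sub_mul_cfc (hA : A.IsHermitian) (hB : B.IsHermitian)
    (f k g : ℝ → ℝ) :
    trace ((cfc f A - cfc f B) * (cfc k A - cfc k B) * cfc g B) =
      ∑ j, ∑ i, (((f (hA.eigenvalues i) - f (hB.eigenvalues j)) *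
        (k (hA.eigenvalues i) - k (hB.eigenvalues j)) * g (hB.eigenvalues j) *
        Complex.normSq (hA.overlap hB i j) : ℝ) : ℂ) := by
  set U := (hB.eigenvectorUnitary : Matrix n n ℂ) with hU
  set V := (hA.eigenvectorUnitary : Matrix n n ℂ) with hV
  have hUU : U * star U = 1 := Unitary.coe_mul_star_self _
  have hVV : V * star V = 1 := Unitary.coe_mul_star_self _
  have hstar : star U * (cfc f A - cfc f B) * V = star (star V * (cfc f A - cfc f B) * U) := by
    have h : star (cfc f A - cfc f B) = cfc f A - cfc f B :=
      ((cfc_predicate f A).sub (cfc_predicate f B)).star_eq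
    simp [h, mul_assoc]
  have key : trace ((cfc f A - cfc f B) * (cfc k A - cfc k B) * cfc g B) =
      trace (star (star V * (cfc f A - cfc f B) * U) * (star V * (cfc k A - cfc k B) * U) *
        diagonal fun i => (g (hB.eigenvalues i) : ℂ)) := by
    calc _ = trace ((cfc f A - cfc f B) * (V * star V) * (cfc k A - cfc k B) * cfc g B *
            (U * star U)) := by rw [hUU, hVV, mul_one, mul_one]
      _ = trace ((cfc f A - cfc f B) * V * (star V * (cfc k A - cfc k B) *
            (cfc g B * U)) * star U) := by simp only [mul_assoc]
      _ = _ := by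
        rw [trace_mul_comm, hU, hB.cfc_mul_eigenvectorUnitary, ← hU, ← hstar]
        simp only [mul_assoc]
  rw [key, trace]
  refine Finset.sum_congr rfl fun j _ => ?_
  rw [diag_apply, mul_diagonal, mul_apply, Finset.sum_mul]
  refine Finset.sum_congr rfl fun i _ => ?_
  rw [star_apply, star_mul_cfc_sub_cfc_mul_apply, star_mul_cfc_sub_cfc_mul_apply]
  push_cast
  rw [Complex.normSq_eq_conj_mul_self]
  simp
  ring

end Matrix.IsHermitian

theorem Real.sub_mul_sub_mul_rpow_le {a b θ : ℝ} (ha : 0 < a) (hb : 0 < b) (hθ : 0 ≤ θ) :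
    (a - b) * (a - b) * b ^ θ ≤ (a - b) * (a ^ (1 + θ) - b ^ (1 + θ)) := by
  rw [Real.rpow_add ha, Real.rpow_add hb, Real.rpow_one, Real.rpow_one]
  have h : 0 ≤ (a - b) * (a ^ θ - b ^ θ) := by
    rcases le_total a b with hab | hab
    · exact mul_nonneg_of_nonpos_of_nonpos (sub_nonpos.2 hab)
        (sub_nonpos.2 (Real.rpow_le_rpow ha.le hab hθ))
    · exact mul_nonneg (sub_nonneg.2 hab) (sub_nonneg.2 (Real.rpow_le_rpow hb.le hab hθ))
  nlinarith [mul_nonneg ha.le h]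

/-- For `n ≥ 1`, a positive definite `n × n` complex matrix `B`, a Hermitian `Δ` with
`B + Δ` positive definite, a real `θ ∈ [0,1]` and a natural number `m ≥ 1`,
`Re (trace (Δ * ((B + Δ)^(1+θ) - B^(1+θ)) * B^m)) ≥ Re (trace (Δ * Δ * B^(m+θ)))`,
where the real powers are given by the continuous functional calculus and `B^m` is the
ordinary matrix power. -/
theorem stmt_7 (n : ℕ) (hn : 1 ≤ n) (B Δ : Matrix (Fin n) (Fin n) ℂ)
    (hB : B.PosDef) (hΔ : Δ.IsHermitian) (hBΔ : (B + Δ).PosDef)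
    (θ : ℝ) (hθ1 : 0 ≤ θ) (hθ2 : θ ≤ 1) (m : ℕ) (hm : 1 ≤ m) :
    (Matrix.trace (Δ *
        (cfc (fun t : ℝ => t ^ (1 + θ)) (B + Δ) - cfc (fun t : ℝ => t ^ (1 + θ)) B) *
        B ^ m)).re ≥
      (Matrix.trace (Δ * Δ * cfc (fun t : ℝ => t ^ ((m : ℝ) + θ)) B)).re := by
  have hBs : IsSelfAdjoint B := hB.isHermitian
  have hAs : IsSelfAdjoint (B + Δ) := hBΔ.isHermitian
  have hΔ_eq : cfc (id : ℝ → ℝ) (B + Δ) - cfc (id : ℝ → ℝ) B = Δ := by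
    rw [cfc_id ℝ (B + Δ), cfc_id ℝ B, add_sub_cancel_left]
  have hl := hBΔ.isHermitian.trace_cfc_sub_mul_cfc_sub_mul_cfc hB.isHermitian
    id (fun t : ℝ => t ^ (1 + θ)) (fun t : ℝ => t ^ m)
  have hr := hBΔ.isHermitian.trace_cfc_sub_mul_cfc_sub_mul_cfc hB.isHermitian
    id id (fun t : ℝ => t ^ ((m : ℝ) + θ))
  rw [hΔ_eq, cfc_pow_id B m] at hl
  rw [hΔ_eq] at hr
  rw [hl, hr, ge_iff_le]
  simp only [← Complex.ofReal_sum, Complex.ofReal_re, id]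
  refine Finset.sum_le_sum fun j _ => Finset.sum_le_sum fun i _ =>
    mul_le_mul_of_nonneg_right ?_ (Complex.normSq_nonneg _)
  have hb := hB.eigenvalues_pos j
  rw [Real.rpow_add hb, Real.rpow_natCast, mul_comm (_ ^ m), ← mul_assoc]
  exact mul_le_mul_of_nonneg_right
    (Real.sub_mul_sub_mul_rpow_le (hBΔ.eigenvalues_pos i) hb hθ1) (pow_nonneg hb.le m)
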